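/- Let F(x) := ∫₀ˣ (1−t⁶)^{−1/2} dt and G(x) := ∫₀ˣ (1−t⁶)^{−5/6} dt. For every S ∈ [0,1], set R := √(1+8S⁶) and T := S · (3+R)^{1/2} / ( 2^{1/6} · (1+8S⁶)^{1/4} · (1+R)^{1/6} ). Then T ∈ [0,1] and G(T) = 2^{2/3} · F(S). (Equivalently, 2 sin_{6/5,6}⁶(2x) = S⁶(3+√(1+8S⁶))³ / ((1+8S⁶)^{3/2}(1+√(1+8S⁶))) where S = sin_{2,6}(2^{1/3}x).) -/

import Mathlib

/-- `F = F_{2,6}`, the incomplete integral `∫₀ˣ (1−t⁶)^{−1/2} dt`. -/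
noncomputable def F26 (x : ℝ) : ℝ := ∫ t in (0:ℝ)..x, (1 - t ^ 6) ^ (-(1/2) : ℝ)

/-- `G = F_{6/5,6}`, the incomplete integral `∫₀ˣ (1−t⁶)^{−5/6} dt`. -/
noncomputable def G656 (x : ℝ) : ℝ := ∫ t in (0:ℝ)..x, (1 - t ^ 6) ^ (-(5/6) : ℝ)

noncomputable def auxR (s : ℝ) : ℝ := Real.sqrt (1 + 8 * s ^ 6)

noncomputable def auxH (s : ℝ) : ℝ :=
  (auxR s - 1) * (3 + auxR s) ^ 3 / (16 * auxR s ^ 3)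

lemma auxR_sq (s : ℝ) : auxR s ^ 2 = 1 + 8 * s ^ 6 := by
  unfold auxR
  exact Real.sq_sqrt (by positivity)

lemma auxR_ge (s : ℝ) : 1 ≤ auxR s := by
  unfold auxR
  rw [Real.one_le_sqrt]
  have : 0 ≤ s ^ 6 := by positivity
  linarith

lemma auxR_le (s : ℝ) (h0 : 0 ≤ s) (h1 : s ≤ 1) : auxR s ≤ 3 := by
  have h := auxR_sq s
  have := auxR_ge s
  have : s ^ 6 ≤ 1 := pow_le_one₀ h0 h1
  nlinarith

lemma auxH_nonneg (s : ℝ) : 0 ≤ auxH s := by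
  have := auxR_ge s
  unfold auxH
  have h1 : 0 ≤ auxR s - 1 := by linarith
  positivity

lemma one_sub_auxH (s : ℝ) :
    1 - auxH s = (3 - auxR s) ^ 3 * (auxR s + 1) / (16 * auxR s ^ 3) := by
  have := auxR_ge s
  have h : auxR s ≠ 0 := by positivity
  unfold auxH
  field_simp
  ring

lemma auxH_le_one (s : ℝ) (h0 : 0 ≤ s) (h1 : s ≤ 1) : auxH s ≤ 1 := by
  have h := one_sub_auxH s
  have h2 := auxR_ge s
  have h3 : 0 ≤ 3 - auxR s := by linarith [auxR_le s h0 h1]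
  have : 0 ≤ 1 - auxH s := by rw [h]; positivity
  linarith

lemma auxH_mul (s : ℝ) :
    auxH s * (1 - auxH s) = 16 * (s / auxR s) ^ 6 * (1 - s ^ 6) ^ 3 := by
  have := auxR_ge s
  have h : auxR s ≠ 0 := by positivity
  have hq := auxR_sq s
  have e1 : s ^ 6 = (auxR s ^ 2 - 1) / 8 := by linarith
  rw [one_sub_auxH, div_pow, e1]
  unfold auxH
  field_simp
  ring

lemma auxT_eq (S : ℝ) (h0 : 0 ≤ S) :
    S * Real.sqrt (3 + Real.sqrt (1 + 8 * S ^ 6))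
        / (2 ^ ((1:ℝ)/6) * (1 + 8 * S ^ 6) ^ ((1:ℝ)/4)
          * (1 + Real.sqrt (1 + 8 * S ^ 6)) ^ ((1:ℝ)/6)) = auxH S ^ ((1:ℝ)/6) := by
  have hR := auxR_ge S
  have hq := auxR_sq S
  have e1 : S ^ 6 = (auxR S ^ 2 - 1) / 8 := by linarith
  change S * Real.sqrt (3 + auxR S)
        / (2 ^ ((1:ℝ)/6) * (1 + 8 * S ^ 6) ^ ((1:ℝ)/4) * (1 + auxR S) ^ ((1:ℝ)/6)) = _
  rw [← hq]
  have a1 : ((auxR S ^ 2) ^ ((1:ℝ)/4)) ^ 6 = auxR S ^ 3 := by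
    rw [← Real.rpow_natCast, ← Real.rpow_natCast, ← Real.rpow_mul (by positivity),
      ← Real.rpow_mul (by positivity), ← Real.rpow_natCast]
    norm_num
  have a2 : ((1 + auxR S) ^ ((1:ℝ)/6)) ^ 6 = 1 + auxR S := by
    rw [← Real.rpow_natCast, ← Real.rpow_mul (by positivity)]
    norm_num
  have a3 : ((2:ℝ) ^ ((1:ℝ)/6)) ^ 6 = 2 := by
    rw [← Real.rpow_natCast, ← Real.rpow_mul (by positivity)]
    norm_num
  have a4 : Real.sqrt (3 + auxR S) ^ 6 = (3 + auxR S) ^ 3 := by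
    rw [show 6 = 2 * 3 by norm_num, pow_mul, Real.sq_sqrt (by positivity)]
  have a5 : (auxH S ^ ((1:ℝ)/6)) ^ 6 = auxH S := by
    rw [← Real.rpow_natCast, ← Real.rpow_mul (auxH_nonneg S)]
    norm_num
  have hnn : 0 ≤ auxH S ^ ((1:ℝ)/6) := Real.rpow_nonneg (auxH_nonneg S) _
  refine (pow_left_inj₀ (by positivity) hnn (show 6 ≠ 0 by norm_num)).1 ?_
  rw [a5, div_pow, mul_pow, mul_pow, mul_pow, a1, a2, a3, a4, e1]
  unfold auxH
  have h : auxR S ≠ 0 := by positivity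
  have h' : 1 + auxR S ≠ 0 := by positivity
  field_simp
  ring

lemma aux_cont (r : ℝ) (x : ℝ) (h0 : 0 ≤ x) (h1 : x < 1) :
    ContinuousAt (fun t : ℝ => (1 - t ^ 6) ^ r) x := by
  have : x ^ 6 < 1 := pow_lt_one₀ h0 h1 (by norm_num)
  exact ContinuousAt.rpow_const (by fun_prop) (Or.inl (by linarith))

lemma aux_int (r : ℝ) (hr : 0 ≤ r) (hr1 : r < 1) :
    IntervalIntegrable (fun t : ℝ => (1 - t ^ 6) ^ (-r)) MeasureTheory.volume 0 1 := by
  have h1 : IntervalIntegrable (fun t : ℝ => t ^ (-r)) MeasureTheory.volume 1 0 :=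
    intervalIntegral.intervalIntegrable_rpow' (by linarith)
  have h2 := h1.comp_sub_left 1
  simp only [sub_self, sub_zero] at h2
  refine h2.mono_fun ?_ ?_
  · exact Measurable.aestronglyMeasurable (by fun_prop)
  · rw [Set.uIoc_of_le zero_le_one]
    have hne : ∀ᵐ t ∂(MeasureTheory.volume : MeasureTheory.Measure ℝ), t ≠ 1 := by
      simp [MeasureTheory.ae_iff]
    filter_upwards [MeasureTheory.ae_restrict_mem measurableSet_Ioc,
      MeasureTheory.ae_restrict_of_ae hne] with t ht htne
    have ht1 : t < 1 := lt_of_le_of_ne ht.2 htne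
    have h6 : t ^ 6 ≤ t := pow_le_of_le_one ht.1.le ht.2 (by norm_num)
    rw [Real.norm_of_nonneg (Real.rpow_nonneg (by linarith) _),
      Real.norm_of_nonneg (Real.rpow_nonneg (by linarith) _)]
    exact Real.rpow_le_rpow_of_nonpos (by linarith) (by linarith) (by linarith)

lemma aux_primcont (r : ℝ) (hr : 0 ≤ r) (hr1 : r < 1) :
    ContinuousOn (fun x : ℝ => ∫ t in (0:ℝ)..x, (1 - t ^ 6) ^ (-r)) (Set.Icc 0 1) := by
  have h := intervalIntegral.continuousOn_primitive_interval (a := (0:ℝ)) (b := 1)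
    (f := fun t : ℝ => (1 - t ^ 6) ^ (-r)) (μ := MeasureTheory.volume)
    (by
      have := (intervalIntegrable_iff_integrableOn_Icc_of_le zero_le_one).1 (aux_int r hr hr1)
      rwa [Set.uIcc_of_le zero_le_one])
  rwa [Set.uIcc_of_le zero_le_one] at h

lemma aux_primderiv (r : ℝ) (hr : 0 ≤ r) (hr1 : r < 1) (x : ℝ) (h0 : 0 < x) (h1 : x < 1) :
    HasDerivAt (fun x : ℝ => ∫ t in (0:ℝ)..x, (1 - t ^ 6) ^ (-r)) ((1 - x ^ 6) ^ (-r)) x := by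
  refine intervalIntegral.integral_hasDerivAt_right ?_ ?_ (aux_cont _ x h0.le h1)
  · refine (aux_int r hr hr1).mono_set ?_
    rw [Set.uIcc_of_le zero_le_one, Set.uIcc_of_le h0.le]
    exact Set.Icc_subset_Icc le_rfl h1.le
  · exact (Measurable.stronglyMeasurable (by fun_prop)).stronglyMeasurableAtFilter

lemma auxR_deriv (s : ℝ) : HasDerivAt auxR (24 * s ^ 5 / auxR s) s := by
  have h : HasDerivAt (fun s : ℝ => 1 + 8 * s ^ 6) (48 * s ^ 5) s := by
    have := ((hasDerivAt_pow 6 s).const_mul 8).const_add 1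
    refine this.congr_deriv ?_
    push_cast
    ring
  have h2 : HasDerivAt auxR _ s := h.sqrt (by positivity)
  refine h2.congr_deriv ?_
  symm
  have : 0 < auxR s := by linarith [auxR_ge s]
  change _ = 48 * s ^ 5 / (2 * auxR s)
  field_simp
  ring

lemma auxH_deriv (s : ℝ) :
    HasDerivAt auxH (96 * s ^ 5 * (1 - s ^ 6) ^ 2 / auxR s ^ 5) s := by
  have hR := auxR_deriv s
  have hp : 0 < auxR s := by linarith [auxR_ge s]
  have h := ((hR.sub_const 1).mul ((hR.const_add 3).pow 3)).div ((hR.pow 3).const_mul 16)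
    (by simp only [Pi.pow_apply]; positivity)
  refine h.congr_deriv ?_
  have hq := auxR_sq s
  have e1 : 1 - s ^ 6 = (9 - auxR s ^ 2) / 8 := by linarith
  rw [e1]
  simp only [Pi.mul_apply, Pi.pow_apply]
  field_simp
  norm_num
  ring

lemma aux_final (s : ℝ) (h0 : 0 < s) (h1 : s < 1) :
    (1 - auxH s) ^ (-(5/6) : ℝ) *
      (96 * s ^ 5 * (1 - s ^ 6) ^ 2 / auxR s ^ 5 * ((1:ℝ)/6) * auxH s ^ ((1:ℝ)/6 - 1))
      = 2 ^ ((2:ℝ)/3) * (1 - s ^ 6) ^ (-(1/2) : ℝ) := by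
  have hH := auxH_nonneg s
  have hH1 : 0 ≤ 1 - auxH s := by linarith [auxH_le_one s h0.le h1.le]
  have hp : 0 < auxR s := by linarith [auxR_ge s]
  have hw : 0 < 1 - s ^ 6 := by linarith [pow_lt_one₀ h0.le h1 (show 6 ≠ 0 by norm_num)]
  have hm : (1 - auxH s) ^ (-(5/6) : ℝ) * auxH s ^ ((1:ℝ)/6 - 1)
      = (16:ℝ) ^ (-(5/6) : ℝ) * ((s / auxR s) ^ 5)⁻¹ * (1 - s ^ 6) ^ (-(5/2) : ℝ) := by
    rw [show ((1:ℝ)/6 - 1) = -(5/6) by norm_num, ← Real.mul_rpow hH1 hH, mul_comm, auxH_mul,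
      Real.mul_rpow (by positivity) (by positivity), Real.mul_rpow (by positivity) (by positivity)]
    congr 1
    · congr 1
      rw [← Real.rpow_natCast, ← Real.rpow_mul (by positivity), ← Real.rpow_natCast,
        ← Real.rpow_neg (by positivity)]
      norm_num
    · rw [← Real.rpow_natCast, ← Real.rpow_mul (by positivity)]
      norm_num
  have e16 : (16:ℝ) ^ (-(5/6) : ℝ) = 2 ^ ((2:ℝ)/3) / 16 := by
    rw [show (16:ℝ) = 2 ^ (4:ℝ) by norm_num, ← Real.rpow_mul (by norm_num),
      ← Real.rpow_sub (by norm_num)]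
    norm_num
  have ew : (1 - s ^ 6) ^ (-(1/2) : ℝ) = (1 - s ^ 6) ^ 2 * (1 - s ^ 6) ^ (-(5/2) : ℝ) := by
    rw [← Real.rpow_natCast (1 - s ^ 6) 2, ← Real.rpow_add hw]
    norm_num
  calc _ = (96 * s ^ 5 * (1 - s ^ 6) ^ 2 / auxR s ^ 5 * ((1:ℝ)/6)) *
        ((1 - auxH s) ^ (-(5/6) : ℝ) * auxH s ^ ((1:ℝ)/6 - 1)) := by ring
    _ = _ := by
      rw [hm, e16, ew]
      generalize (1 - s ^ 6) ^ (-(5/2) : ℝ) = a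
      generalize (1 - s ^ 6) ^ 2 = b
      generalize (2:ℝ) ^ ((2:ℝ)/3) = c
      field_simp
      ring

/-- The key identity `2 sin_{6/5,6}⁶(2x) = S⁶(3+√(1+8S⁶))³/((1+8S⁶)^{3/2}(1+√(1+8S⁶)))`
with `S = sin_{2,6}(2^{1/3} x)`, expressed via the integrals. -/
theorem key_identity_six_fifths_six (S : ℝ) (hS : S ∈ Set.Icc (0:ℝ) 1) :
    (S * Real.sqrt (3 + Real.sqrt (1 + 8 * S ^ 6))
        / (2 ^ ((1:ℝ)/6) * (1 + 8 * S ^ 6) ^ ((1:ℝ)/4)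
          * (1 + Real.sqrt (1 + 8 * S ^ 6)) ^ ((1:ℝ)/6)))
      ∈ Set.Icc (0:ℝ) 1 ∧
    G656 (S * Real.sqrt (3 + Real.sqrt (1 + 8 * S ^ 6))
        / (2 ^ ((1:ℝ)/6) * (1 + 8 * S ^ 6) ^ ((1:ℝ)/4)
          * (1 + Real.sqrt (1 + 8 * S ^ 6)) ^ ((1:ℝ)/6)))
      = 2 ^ ((2:ℝ)/3) * F26 S := by
  rw [auxT_eq S hS.1]
  have hmem : ∀ s ∈ Set.Icc (0:ℝ) 1, auxH s ^ ((1:ℝ)/6) ∈ Set.Icc (0:ℝ) 1 := fun s hs =>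
    ⟨Real.rpow_nonneg (auxH_nonneg s) _,
      Real.rpow_le_one (auxH_nonneg s) (auxH_le_one s hs.1 hs.2) (by norm_num)⟩
  refine ⟨hmem S hS, ?_⟩
  have hHc : Continuous auxH :=
    continuous_iff_continuousAt.2 fun s => (auxH_deriv s).continuousAt
  have hz : auxH 0 = 0 := by simp [auxH, auxR]
  have hG : ContinuousOn G656 (Set.Icc 0 1) := aux_primcont (5/6) (by norm_num) (by norm_num)
  have hF : ContinuousOn F26 (Set.Icc 0 1) := aux_primcont (1/2) (by norm_num) (by norm_num)
  rcases hS.1.eq_or_lt with h | hpos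
  · rw [← h, hz]
    simp [G656, F26]
  let Φ : ℝ → ℝ := fun s => G656 (auxH s ^ ((1:ℝ)/6)) - 2 ^ ((2:ℝ)/3) * F26 s
  have hTc : Continuous fun s => auxH s ^ ((1:ℝ)/6) :=
    hHc.rpow_const fun _ => Or.inr (by norm_num)
  have hc1 : ContinuousOn Φ (Set.Icc 0 1) :=
    (hG.comp hTc.continuousOn hmem).sub (continuousOn_const.mul hF)
  have hc : ContinuousOn Φ (Set.Icc 0 S) := hc1.mono (Set.Icc_subset_Icc le_rfl hS.2)
  have hd : ∀ s ∈ Set.Ioo 0 S, HasDerivAt Φ 0 s := by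
    intro s hs
    have s0 : 0 < s := hs.1
    have s1 : s < 1 := hs.2.trans_le hS.2
    have hp : 0 < auxR s := by linarith [auxR_ge s]
    have hw : 0 < 1 - s ^ 6 := by linarith [pow_lt_one₀ s0.le s1 (show 6 ≠ 0 by norm_num)]
    have hprod : 0 < auxH s * (1 - auxH s) := by rw [auxH_mul]; positivity
    have hHpos : 0 < auxH s := by
      rcases (auxH_nonneg s).eq_or_lt with h | h
      · rw [← h] at hprod; simp at hprod
      · exact h
    have hH1 : auxH s < 1 := by
      have := (mul_pos_iff_of_pos_left hHpos).1 hprod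
      linarith
    have hT := (auxH_deriv s).rpow_const (p := (1:ℝ)/6) (Or.inl hHpos.ne')
    have hT0 : 0 < auxH s ^ ((1:ℝ)/6) := Real.rpow_pos_of_pos hHpos _
    have hT1 : auxH s ^ ((1:ℝ)/6) < 1 := Real.rpow_lt_one hHpos.le hH1 (by norm_num)
    have hGd : HasDerivAt G656 _ _ :=
      aux_primderiv (5/6) (by norm_num) (by norm_num) _ hT0 hT1
    have hFd : HasDerivAt F26 _ _ := aux_primderiv (1/2) (by norm_num) (by norm_num) s s0 s1
    have a5 : (auxH s ^ ((1:ℝ)/6)) ^ 6 = auxH s := by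
      rw [← Real.rpow_natCast, ← Real.rpow_mul (auxH_nonneg s)]
      norm_num
    have := (hGd.comp s hT).sub (hFd.const_mul (2 ^ ((2:ℝ)/3)))
    refine this.congr_deriv ?_
    rw [a5, aux_final s s0 s1, sub_self]
  obtain ⟨c, _, hcs⟩ := exists_hasDerivAt_eq_slope Φ (fun _ => 0) hpos hc hd
  have h0 : Φ 0 = 0 := by simp [Φ, hz, G656, F26]
  have hS0 : Φ S = 0 := by
    rw [h0, sub_zero, sub_zero] at hcs
    rcases div_eq_zero_iff.1 hcs.symm with h | h
    · exact h
    · exact absurd h hpos.ne'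
  exact sub_eq_zero.1 hS0
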